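/- Let d ≥ 1, let P be a probability measure on ℝ^d with finite first moment (∫ ‖x‖ dP(x) < ∞), and let σ > 0. Then for every y ∈ ℝ^d the score of the smoothed density is the rescaled posterior mean of the clean point: ∇log Q_σ(y) = σ^{-2} · ( (∫ x · q_σ(y, x) dP(x)) / Q_σ(y) − y ). -/

import Mathlib

open MeasureTheory Real Filter Topology
open scoped InnerProductSpace ENNReal BigOperators

/-- The Gaussian kernel `q_σ(y, x) = (2πσ²)^{-d/2} exp(−‖y − x‖²/(2σ²))` on `ℝ^d`. -/
noncomputable def gaussKernel (d : ℕ) (σ : ℝ) (y x : EuclideanSpace ℝ (Fin d)) : ℝ :=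
  (2 * π * σ ^ 2) ^ (-(d : ℝ) / 2) * Real.exp (-‖y - x‖ ^ 2 / (2 * σ ^ 2))

/-- The smoothed density `Q_σ(y) = ∫ q_σ(y, x) dP(x)`. -/
noncomputable def smoothedDensity (d : ℕ) (σ : ℝ)
    (P : Measure (EuclideanSpace ℝ (Fin d))) (y : EuclideanSpace ℝ (Fin d)) : ℝ :=
  ∫ x, gaussKernel d σ y x ∂P

/-- The score `∇ log Q_σ` of the smoothed density. -/
noncomputable def score (d : ℕ) (σ : ℝ) (P : Measure (EuclideanSpace ℝ (Fin d)))
    (y : EuclideanSpace ℝ (Fin d)) : EuclideanSpace ℝ (Fin d) :=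
  gradient (fun z => Real.log (smoothedDensity d σ P z)) y

theorem gaussKernel_pos (d : ℕ) {σ : ℝ} (hσ : 0 < σ) (y x : EuclideanSpace ℝ (Fin d)) :
    0 < gaussKernel d σ y x := by
  unfold gaussKernel
  positivity

theorem gaussKernel_le (d : ℕ) (σ : ℝ) (y x : EuclideanSpace ℝ (Fin d)) :
    gaussKernel d σ y x ≤ (2 * π * σ ^ 2) ^ (-(d : ℝ) / 2) := by
  unfold gaussKernel
  refine mul_le_of_le_one_right (by positivity) (Real.exp_le_one_iff.2 ?_)
  exact div_nonpos_of_nonpos_of_nonneg (neg_nonpos.2 (by positivity)) (by positivity)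

theorem norm_gaussKernel_le (d : ℕ) {σ : ℝ} (hσ : 0 < σ) (y x : EuclideanSpace ℝ (Fin d)) :
    ‖gaussKernel d σ y x‖ ≤ (2 * π * σ ^ 2) ^ (-(d : ℝ) / 2) := by
  rw [Real.norm_of_nonneg (gaussKernel_pos d hσ y x).le]
  exact gaussKernel_le d σ y x

theorem continuous_gaussKernel (d : ℕ) (σ : ℝ) (y : EuclideanSpace ℝ (Fin d)) :
    Continuous (gaussKernel d σ y) := by
  unfold gaussKernel
  fun_prop

theorem integrable_gaussKernel (d : ℕ) {σ : ℝ} (hσ : 0 < σ)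
    (P : Measure (EuclideanSpace ℝ (Fin d))) [IsFiniteMeasure P] (y : EuclideanSpace ℝ (Fin d)) :
    Integrable (gaussKernel d σ y) P :=
  .of_bound (continuous_gaussKernel d σ y).aestronglyMeasurable _
    (.of_forall fun x => norm_gaussKernel_le d hσ y x)

theorem integrable_gaussKernel_smul (d : ℕ) {σ : ℝ} (hσ : 0 < σ)
    {P : Measure (EuclideanSpace ℝ (Fin d))} (y : EuclideanSpace ℝ (Fin d))
    {f : EuclideanSpace ℝ (Fin d) → EuclideanSpace ℝ (Fin d)} (hf : Integrable f P) :
    Integrable (fun x => gaussKernel d σ y x • f x) P :=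
  hf.bdd_smul _ (continuous_gaussKernel d σ y).aestronglyMeasurable
    (.of_forall fun x => norm_gaussKernel_le d hσ y x)

theorem hasFDerivAt_gaussKernel (d : ℕ) {σ : ℝ} (hσ : 0 < σ) (y x : EuclideanSpace ℝ (Fin d)) :
    HasFDerivAt (fun z => gaussKernel d σ z x)
      (innerSL ℝ ((σ ^ 2)⁻¹ • gaussKernel d σ y x • (x - y))) y := by
  unfold gaussKernel
  have h := (((((hasFDerivAt_id y).sub_const x).norm_sq).neg.mul_const
    (2 * σ ^ 2)⁻¹).exp).const_mul ((2 * π * σ ^ 2) ^ (-(d : ℝ) / 2))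
  simp only [← div_eq_mul_inv, id] at h
  refine h.congr_fderiv ?_
  ext v
  simp
  field_simp
  ring

theorem smoothedDensity_pos (d : ℕ) {σ : ℝ} (hσ : 0 < σ)
    (P : Measure (EuclideanSpace ℝ (Fin d))) [IsProbabilityMeasure P]
    (y : EuclideanSpace ℝ (Fin d)) : 0 < smoothedDensity d σ P y := by
  refine (integral_pos_iff_support_of_nonneg (fun x => (gaussKernel_pos d hσ y x).le)
    (integrable_gaussKernel d hσ P y)).2 ?_
  have : Function.support (gaussKernel d σ y) = Set.univ :=
    Set.eq_univ_of_forall fun x => (gaussKernel_pos d hσ y x).ne'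
  simp [this]

theorem hasGradientAt_smoothedDensity (d : ℕ) {σ : ℝ} (hσ : 0 < σ)
    (P : Measure (EuclideanSpace ℝ (Fin d))) [IsFiniteMeasure P] (hP : Integrable (fun x => x) P)
    (y : EuclideanSpace ℝ (Fin d)) :
    HasGradientAt (smoothedDensity d σ P)
      ((σ ^ 2)⁻¹ • ((∫ x, gaussKernel d σ y x • x ∂P) - smoothedDensity d σ P y • y)) y := by
  have hint : Integrable (fun x => (σ ^ 2)⁻¹ • gaussKernel d σ y x • (x - y)) P :=
    (integrable_gaussKernel_smul d hσ y (hP.sub (integrable_const y))).smul (σ ^ 2)⁻¹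
  have key : HasFDerivAt (smoothedDensity d σ P)
      (∫ x, innerSL ℝ ((σ ^ 2)⁻¹ • gaussKernel d σ y x • (x - y)) ∂P) y := by
    refine hasFDerivAt_integral_of_dominated_of_fderiv_le
      (F' := fun z x => innerSL ℝ ((σ ^ 2)⁻¹ • gaussKernel d σ z x • (x - z)))
      (bound := fun x => (σ ^ 2)⁻¹ * ((2 * π * σ ^ 2) ^ (-(d : ℝ) / 2) * (‖x‖ + (‖y‖ + 1))))
      (Metric.ball_mem_nhds y one_pos)
      (.of_forall fun z => (continuous_gaussKernel d σ z).aestronglyMeasurable)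
      (integrable_gaussKernel d hσ P y)
      ((innerSL ℝ).continuous.comp_aestronglyMeasurable hint.aestronglyMeasurable)
      (.of_forall fun x z hz => ?_)
      (((hP.norm.add (integrable_const _)).const_mul _).const_mul _)
      (.of_forall fun x z _ => hasFDerivAt_gaussKernel d hσ z x)
    have hz' : ‖z‖ ≤ ‖y‖ + 1 := by
      have h := norm_le_norm_add_norm_sub' z y
      rw [mem_ball_iff_norm] at hz
      linarith
    rw [innerSL_apply_norm, norm_smul, norm_smul, Real.norm_of_nonneg (by positivity)]
    gcongr
    · exact norm_gaussKernel_le d hσ z x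
    · exact (norm_sub_le x z).trans (by gcongr)
  rw [hasGradientAt_iff_hasFDerivAt]
  refine key.congr_fderiv ?_
  rw [ContinuousLinearMap.integral_comp_comm (innerSL ℝ) hint, integral_smul]
  simp_rw [smul_sub (gaussKernel d σ y _)]
  rw [integral_sub (integrable_gaussKernel_smul d hσ y (f := fun x => x) hP)
    ((integrable_gaussKernel d hσ P y).smul_const y), integral_smul_const]
  rfl

/-- The score of the smoothed density is the rescaled posterior mean of the clean point:
`∇log Q_σ(y) = σ^{-2} • ((∫ x q_σ(y,x) dP(x)) / Q_σ(y) − y)`. -/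
theorem score_eq_rescaled_posterior_mean
    (d : ℕ) (hd : 1 ≤ d)
    (P : Measure (EuclideanSpace ℝ (Fin d))) [IsProbabilityMeasure P]
    (hmom : Integrable (fun x => ‖x‖) P)
    (σ : ℝ) (hσ : 0 < σ) :
    ∀ y, score d σ P y
      = (σ ^ 2)⁻¹ • ((smoothedDensity d σ P y)⁻¹ • (∫ x, gaussKernel d σ y x • x ∂P) - y) := by
  intro y
  have hP : Integrable (fun x => x) P := (integrable_norm_iff aestronglyMeasurable_id).1 hmom
  have hpos := smoothedDensity_pos d hσ P y
  have h := ((hasGradientAt_iff_hasFDerivAt.1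
    (hasGradientAt_smoothedDensity d hσ P hP y)).log hpos.ne')
  rw [← map_smul, ← hasGradientAt_iff_hasFDerivAt] at h
  rw [score, h.gradient, smul_comm, smul_sub, inv_smul_smul₀ hpos.ne']
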